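/- For every ε > 0 there exists m ∈ ℕ⁺ such that for every n ≥ m and every sequence (a₁, …, a_n) of natural numbers there exists k ∈ {1, …, m} with λ₁(R(a₁, …, a_{k−1}, 0, a_k, …, a_n)) < (λ₁(R(a₁, …, a_n)) + ε) / (1 + ε/2). -/

import Mathlib

open Classical

/-- An eigenvalue of a real matrix indexed by a finite type. -/
def IsEigenvalue {V : Type*} [Fintype V] (A : Matrix V V ℝ) (μ : ℝ) : Prop :=
  ∃ v : V → ℝ, v ≠ 0 ∧ A.mulVec v = μ • v

/-- The adjacency matrix (over ℝ) of a simple graph. -/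
noncomputable def adjMat {V : Type*} [Fintype V] (G : SimpleGraph V) : Matrix V V ℝ :=
  fun i j => if G.Adj i j then 1 else 0

/-- The smallest eigenvalue of a real matrix. -/
noncomputable def minEig {V : Type*} [Fintype V] (A : Matrix V V ℝ) : ℝ :=
  sInf {μ : ℝ | IsEigenvalue A μ}

/-- The rowing graph `R(a₁, …, aₙ)` for `a = [a₁, …, aₙ]`. The central path
`v₋₂ v₋₁ v₀ v₁ ⋯ vₙ` is indexed by `Fin (n + 3)` (index `t` is `v_{t-2}`), the coxswain is
the `Unit` vertex (joined to `v₀`, i.e. index `2`), and for each `i : Fin n` a clique on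
`aᵢ₊₁` vertices is joined to `vᵢ` and `vᵢ₊₁` (indices `i + 2` and `i + 3`). -/
def rowingGraph (a : List ℕ) :
    SimpleGraph (Fin (a.length + 3) ⊕ (Unit ⊕ (Σ i : Fin a.length, Fin (a.get i)))) :=
  SimpleGraph.fromRel fun x y =>
    match x, y with
    | Sum.inl s, Sum.inl t => (t : ℕ) = (s : ℕ) + 1
    | Sum.inr (Sum.inl _), Sum.inl t => (t : ℕ) = 2
    | Sum.inr (Sum.inr p), Sum.inl t => (t : ℕ) = (p.1 : ℕ) + 2 ∨ (t : ℕ) = (p.1 : ℕ) + 3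
    | Sum.inr (Sum.inr p), Sum.inr (Sum.inr q) => p.1 = q.1
    | _, _ => False

/-- The smallest eigenvalue of the rowing graph `R(a)`. -/
noncomputable def rowingMinEig (a : List ℕ) : ℝ :=
  minEig (adjMat (rowingGraph a))

open Finset Matrix

section SmallestEigenvalue

variable {V : Type*} [Fintype V]

lemma IsEigenvalue.hasEigenvalue {A : Matrix V V ℝ} {μ : ℝ} (h : IsEigenvalue A μ) :
    Module.End.HasEigenvalue (Matrix.toLin' A) μ := by
  obtain ⟨v, hv, hAv⟩ := h
  exact Module.End.hasEigenvalue_of_hasEigenvector (x := v)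
    ⟨Module.End.mem_eigenspace_iff.2 (by simpa using hAv), hv⟩

lemma finite_setOf_isEigenvalue (A : Matrix V V ℝ) : {μ : ℝ | IsEigenvalue A μ}.Finite :=
  (Module.End.finite_hasEigenvalue (Matrix.toLin' A)).subset fun _ h => h.hasEigenvalue

lemma isEigenvalue_eigenvalues {A : Matrix V V ℝ} (hA : A.IsHermitian) (i : V) :
    IsEigenvalue A (hA.eigenvalues i) :=
  ⟨hA.eigenvectorBasis i, by
    intro h
    exact hA.eigenvectorBasis.orthonormal.ne_zero i (by ext j; exact congrFun h j),
    hA.mulVec_eigenvectorBasis i⟩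

lemma isEigenvalue_minEig [Nonempty V] {A : Matrix V V ℝ} (hA : A.IsHermitian) :
    IsEigenvalue A (minEig A) :=
  Set.Nonempty.csInf_mem (s := {μ : ℝ | IsEigenvalue A μ})
    ⟨_, isEigenvalue_eigenvalues hA (Classical.arbitrary V)⟩ (finite_setOf_isEigenvalue A)

lemma minEig_mul_dotProduct_le {A : Matrix V V ℝ} (hA : A.IsHermitian) (y : V → ℝ) :
    minEig A * (y ⬝ᵥ y) ≤ y ⬝ᵥ (A *ᵥ y) := by
  have hB : (A - minEig A • (1 : Matrix V V ℝ)).IsHermitian :=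
    hA.sub (by simp [Matrix.IsHermitian])
  have hpos : (A - minEig A • (1 : Matrix V V ℝ)).PosSemidef := by
    rw [hB.posSemidef_iff_eigenvalues_nonneg]
    intro i
    obtain ⟨v, hv, hBv⟩ := isEigenvalue_eigenvalues hB i
    have hmem : IsEigenvalue A (hB.eigenvalues i + minEig A) := by
      refine ⟨v, hv, ?_⟩
      rw [Matrix.sub_mulVec, Matrix.smul_mulVec, Matrix.one_mulVec] at hBv
      rw [add_smul, ← hBv, sub_add_cancel]
    have := csInf_le (finite_setOf_isEigenvalue A).bddBelow hmem
    change minEig A ≤ _ at this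
    simpa using this
  have := hpos.dotProduct_mulVec_nonneg y
  simp only [star_trivial, Matrix.sub_mulVec, Matrix.smul_mulVec, Matrix.one_mulVec,
    dotProduct_sub, dotProduct_smul, smul_eq_mul] at this
  linarith

lemma isHermitian_adjMat (G : SimpleGraph V) : (adjMat G).IsHermitian := by
  ext i j
  simp [adjMat, G.adj_comm]

lemma minEig_adjMat_nonpos [Nonempty V] (G : SimpleGraph V) : minEig (adjMat G) ≤ 0 := by
  have := minEig_mul_dotProduct_le (isHermitian_adjMat G)
    (Pi.single (Classical.arbitrary V) (1 : ℝ))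
  simpa [adjMat] using this

end SmallestEigenvalue

/-- Vertex weights on `R(a)`: `p` on the central path, `c` on the coxswain, `s` on the cliques. -/
def rowingVec (a : List ℕ) (p : ℕ → ℝ) (c : ℝ) (s : ℕ → ℕ → ℝ) :
    Fin (a.length + 3) ⊕ (Unit ⊕ (Σ i : Fin a.length, Fin (a.get i))) → ℝ :=
  Sum.elim (fun t => p t) (Sum.elim (fun _ => c) fun q => s q.1 q.2)

lemma exists_eq_rowingVec (a : List ℕ)
    (x : Fin (a.length + 3) ⊕ (Unit ⊕ (Σ i : Fin a.length, Fin (a.get i))) → ℝ) :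
    ∃ p c s, x = rowingVec a p c s := by
  refine ⟨fun t => if h : t < a.length + 3 then x (.inl ⟨t, h⟩) else 0, x (.inr (.inl ())),
    fun i j => if h : ∃ hi : i < a.length, j < a.get ⟨i, hi⟩ then
      x (.inr (.inr ⟨⟨i, h.1⟩, ⟨j, h.2⟩⟩)) else 0, ?_⟩
  ext (t | _ | ⟨i, j⟩)
  · simp [rowingVec]
  · simp [rowingVec]
  · have h : ∃ hi : (i : ℕ) < a.length, (j : ℕ) < a.get ⟨i, hi⟩ := ⟨i.2, j.2⟩
    simp only [rowingVec, Sum.elim_inr]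
    rw [dif_pos h]

/-- Squared norm of a weight vector with `n` cliques of sizes `g 0, …, g (n - 1)`. -/
def rowingNormSq (n : ℕ) (g : ℕ → ℕ) (p : ℕ → ℝ) (c : ℝ) (s : ℕ → ℕ → ℝ) : ℝ :=
  ∑ t ∈ range (n + 3), p t ^ 2 + c ^ 2 + ∑ i ∈ range n, ∑ j ∈ range (g i), s i j ^ 2

/-- Adjacency quadratic form of a rowing graph with `n` cliques of sizes
`g 0, …, g (n - 1)`. -/
def rowingQuad (n : ℕ) (g : ℕ → ℕ) (p : ℕ → ℝ) (c : ℝ) (s : ℕ → ℕ → ℝ) : ℝ :=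
  2 * ∑ t ∈ range (n + 2), p t * p (t + 1) + 2 * (c * p 2) +
    ∑ i ∈ range n, (2 * (∑ j ∈ range (g i), s i j) * (p (i + 2) + p (i + 3)) +
      (∑ j ∈ range (g i), s i j) ^ 2 - ∑ j ∈ range (g i), s i j ^ 2)

lemma sum_fin_get (a : List ℕ) (i : Fin a.length) (f : ℕ → ℝ) :
    ∑ j : Fin (a.get i), f j = ∑ j ∈ range (a.getD i 0), f j := by
  rw [Fin.sum_univ_eq_sum_range]
  simp

lemma rowingVec_dotProduct_self (a : List ℕ) (p : ℕ → ℝ) (c : ℝ) (s : ℕ → ℕ → ℝ) :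
    rowingVec a p c s ⬝ᵥ rowingVec a p c s =
      rowingNormSq a.length (fun i => a.getD i 0) p c s := by
  simp only [rowingVec, rowingNormSq, dotProduct, Fintype.sum_sum_type, Fintype.sum_sigma,
    Sum.elim_inl, Sum.elim_inr, ← pow_two, univ_unique, sum_singleton, add_assoc]
  rw [Finset.sum_range, Finset.sum_range (n := a.length)]
  simp_rw [← sum_fin_get]

lemma sum_fin_path (N : ℕ) (p : ℕ → ℝ) :
    ∑ u : Fin (N + 1), ∑ v : Fin (N + 1), (if (v : ℕ) = u + 1 then p u * p v else 0) =
      ∑ t ∈ range N, p t * p (t + 1) := by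
  have hin : ∀ u : Fin (N + 1), ∑ v : Fin (N + 1), (if (v : ℕ) = u + 1 then p u * p v else 0) =
      ∑ v ∈ range (N + 1), if v = (u : ℕ) + 1 then p u * p v else 0 := fun u =>
    Fin.sum_univ_eq_sum_range (fun v => if v = (u : ℕ) + 1 then p u * p v else 0) (N + 1)
  rw [sum_congr rfl fun u _ => hin u, Fin.sum_univ_eq_sum_range
    (fun u => ∑ v ∈ range (N + 1), if v = u + 1 then p u * p v else 0), sum_range_succ]
  simp only [Finset.sum_ite_eq', mem_range]
  rw [if_neg (by omega), add_zero]
  exact sum_congr rfl fun t ht => if_pos (by simpa using ht)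

lemma sum_fin_ite_val_eq (N m : ℕ) (hm : m < N) (f : ℕ → ℝ) :
    ∑ t : Fin N, (if (t : ℕ) = m then f t else 0) = f m := by
  rw [Fin.sum_univ_eq_sum_range (fun t => if t = m then f t else 0)]
  simp [hm]

lemma rowingVec_dotProduct_mulVec (a : List ℕ) (p : ℕ → ℝ) (c : ℝ) (s : ℕ → ℕ → ℝ) :
    rowingVec a p c s ⬝ᵥ (adjMat (rowingGraph a) *ᵥ rowingVec a p c s) =
      rowingQuad a.length (fun i => a.getD i 0) p c s := by
  have hpp : ∀ u v : Fin (a.length + 3), p u * (adjMat (rowingGraph a) (.inl u) (.inl v) * p v) =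
      (if (v : ℕ) = u + 1 then p u * p v else 0) + (if (u : ℕ) = v + 1 then p v * p u else 0) := by
    intro u v
    simp only [adjMat, rowingGraph, SimpleGraph.fromRel_adj, ne_eq, Sum.inl.injEq, Fin.ext_iff]
    split_ifs <;> first | omega | ring
  have hpc : ∀ (u : Fin (a.length + 3)) (w : Unit),
      adjMat (rowingGraph a) (.inl u) (.inr (.inl w)) = if (u : ℕ) = 2 then 1 else 0 := by
    intro u w
    simp [adjMat, rowingGraph, SimpleGraph.fromRel_adj]
  have hcp : ∀ (u : Fin (a.length + 3)) (w : Unit),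
      adjMat (rowingGraph a) (.inr (.inl w)) (.inl u) = if (u : ℕ) = 2 then 1 else 0 := by
    intro u w
    simp [adjMat, rowingGraph, SimpleGraph.fromRel_adj]
  have hcc : ∀ w w' : Unit,
      adjMat (rowingGraph a) (.inr (.inl w)) (.inr (.inl w')) = 0 := by
    intro w w'
    simp [adjMat]
  have hcs : ∀ (w : Unit) (q : Σ i : Fin a.length, Fin (a.get i)),
      adjMat (rowingGraph a) (.inr (.inl w)) (.inr (.inr q)) = 0 := by
    intro w q
    simp [adjMat, rowingGraph, SimpleGraph.fromRel_adj]
  have hsc : ∀ (w : Unit) (q : Σ i : Fin a.length, Fin (a.get i)),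
      adjMat (rowingGraph a) (.inr (.inr q)) (.inr (.inl w)) = 0 := by
    intro w q
    simp [adjMat, rowingGraph, SimpleGraph.fromRel_adj]
  have hps : ∀ (u : Fin (a.length + 3)) (q : Σ i : Fin a.length, Fin (a.get i)),
      adjMat (rowingGraph a) (.inl u) (.inr (.inr q)) =
        (if (u : ℕ) = q.1 + 2 then 1 else 0) + (if (u : ℕ) = q.1 + 3 then 1 else 0) := by
    intro u q
    simp only [adjMat, rowingGraph, SimpleGraph.fromRel_adj, ne_eq, reduceCtorEq,
      not_false_eq_true, true_and, false_or]
    split_ifs <;> first | omega | simp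
  have hsp : ∀ (u : Fin (a.length + 3)) (q : Σ i : Fin a.length, Fin (a.get i)),
      adjMat (rowingGraph a) (.inr (.inr q)) (.inl u) =
        (if (u : ℕ) = q.1 + 2 then 1 else 0) + (if (u : ℕ) = q.1 + 3 then 1 else 0) := by
    intro u q
    simp only [adjMat, rowingGraph, SimpleGraph.fromRel_adj, ne_eq, reduceCtorEq,
      not_false_eq_true, true_and, or_false]
    split_ifs <;> first | omega | simp
  have hss : ∀ q r : Σ i : Fin a.length, Fin (a.get i),
      adjMat (rowingGraph a) (.inr (.inr q)) (.inr (.inr r)) =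
        (if q.1 = r.1 then 1 else 0) - (if q = r then 1 else 0) := by
    intro q r
    simp only [adjMat, rowingGraph, SimpleGraph.fromRel_adj, ne_eq, Sum.inr.injEq]
    by_cases h : q = r
    · simp [h]
    · by_cases h1 : q.1 = r.1 <;> simp [h, h1, eq_comm]
  have hp : ∑ u : Fin (a.length + 3), ∑ v : Fin (a.length + 3),
      p u * (adjMat (rowingGraph a) (.inl u) (.inl v) * p v) =
        2 * ∑ t ∈ range (a.length + 2), p t * p (t + 1) := by
    simp_rw [hpp, sum_add_distrib]
    rw [sum_comm (f := fun u v : Fin (a.length + 3) => if (u : ℕ) = v + 1 then p v * p u else 0),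
      sum_fin_path (a.length + 2) p]
    ring
  obtain ⟨P, hP⟩ : ∃ P : ℕ → ℝ, ∀ i, P i = p (i + 2) + p (i + 3) := ⟨_, fun _ => rfl⟩
  have hsum : ∀ i : Fin a.length,
      ∑ u : Fin (a.length + 3), p u * ((if (u : ℕ) = i + 2 then 1 else 0) +
        (if (u : ℕ) = i + 3 then 1 else 0)) = P i := by
    intro i
    simp_rw [hP, mul_add, mul_ite, mul_one, mul_zero, sum_add_distrib]
    rw [sum_fin_ite_val_eq _ _ (by omega) p, sum_fin_ite_val_eq _ _ (by omega) p]
  have hc : ∑ u : Fin (a.length + 3), p u * (if (u : ℕ) = 2 then 1 else 0) = p 2 := by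
    simp_rw [mul_ite, mul_one, mul_zero]
    exact sum_fin_ite_val_eq _ _ (by omega) p
  have hq : ∑ q : (Σ i : Fin a.length, Fin (a.get i)), s q.1 q.2 * P q.1 =
      ∑ i ∈ range a.length, (∑ j ∈ range (a.getD i 0), s i j) * P i := by
    rw [Fintype.sum_sigma, Finset.sum_range]
    simp_rw [← sum_fin_get, Finset.sum_mul]
  have hclique : ∑ q : (Σ i : Fin a.length, Fin (a.get i)),
      ∑ r : (Σ i : Fin a.length, Fin (a.get i)),
      s q.1 q.2 * (((if q.1 = r.1 then 1 else 0) - (if q = r then 1 else 0)) * s r.1 r.2) =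
      ∑ i ∈ range a.length, ((∑ j ∈ range (a.getD i 0), s i j) ^ 2 -
        ∑ j ∈ range (a.getD i 0), s i j ^ 2) := by
    simp_rw [sub_mul, mul_sub, sum_sub_distrib]
    congr 1
    · simp_rw [Fintype.sum_sigma, ite_mul, one_mul, zero_mul, mul_ite, mul_zero]
      rw [Finset.sum_range]
      refine sum_congr rfl fun i _ => ?_
      rw [← sum_fin_get, pow_two, Finset.sum_mul]
      refine sum_congr rfl fun j _ => ?_
      rw [Finset.sum_eq_single i (fun b _ hb => by simp [hb.symm]) (by simp), Finset.mul_sum]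
      simp
    · simp only [ite_mul, one_mul, zero_mul, mul_ite, mul_zero, sum_ite_eq, mem_univ, if_true,
        ← pow_two, Fintype.sum_sigma]
      rw [Finset.sum_range]
      simp_rw [← sum_fin_get]
  simp only [dotProduct, mulVec, Fintype.sum_sum_type, rowingVec, Sum.elim_inl, Sum.elim_inr,
    univ_unique, sum_singleton, hpc, hcp, hcc, hcs, hsc, hps, hsp, hss]
  have hcomm : ∀ w : Fin (a.length + 3) → (Σ i : Fin a.length, Fin (a.get i)) → ℝ,
      ∑ u : Fin (a.length + 3), p u * ∑ q, w u q * s q.1 q.2 =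
        ∑ q : (Σ i : Fin a.length, Fin (a.get i)), s q.1 q.2 *
          ∑ u : Fin (a.length + 3), p u * w u q := by
    intro w
    simp_rw [Finset.mul_sum]
    rw [sum_comm]
    exact sum_congr rfl fun q _ => sum_congr rfl fun u _ => by ring
  have hpc' : ∑ u : Fin (a.length + 3), p u * ((if (u : ℕ) = 2 then 1 else 0) * c) =
      c * p 2 := by
    rw [← hc, Finset.mul_sum]
    exact sum_congr rfl fun u _ => by ring
  have hcp' : ∑ u : Fin (a.length + 3), (if (u : ℕ) = 2 then 1 else 0) * p u = p 2 := by
    rw [← hc]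
    exact sum_congr rfl fun u _ => mul_comm _ _
  have hsp' : ∀ q : (Σ i : Fin a.length, Fin (a.get i)),
      ∑ u : Fin (a.length + 3), ((if (u : ℕ) = q.1 + 2 then 1 else 0) +
        (if (u : ℕ) = q.1 + 3 then 1 else 0)) * p u = P q.1 := by
    intro q
    rw [← hsum]
    exact sum_congr rfl fun u _ => mul_comm _ _
  simp only [hsp', hcp', mul_add (p _), mul_add (s _ _), sum_add_distrib, hpc', zero_mul,
    mul_zero, sum_const_zero, add_zero]
  simp only [hcomm, hsum, hq]
  simp only [Finset.mul_sum (s := univ), hclique]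
  rw [hp, rowingQuad, sum_sub_distrib]
  simp only [← hP, sum_sub_distrib, sum_add_distrib, mul_assoc, ← Finset.mul_sum]
  ring

lemma sum_range_succ_of_insert {M : Type*} [AddCommMonoid M] {n k : ℕ} (hk : k ≤ n)
    {f f' : ℕ → M} (h₁ : ∀ i < k, f' i = f i) (h₂ : ∀ i, k ≤ i → f' (i + 1) = f i) :
    ∑ i ∈ range (n + 1), f' i = ∑ i ∈ range n, f i + f' k := by
  induction n, hk using Nat.le_induction with
  | base =>
    rw [sum_range_succ, sum_congr rfl fun i hi => h₁ i (by simpa using hi)]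
  | succ n hn ih =>
    rw [sum_range_succ, ih, h₂ n hn, sum_range_succ, add_right_comm]

/-- Doubling the path vertex of index `k + 2` and negating everything to its right. -/
lemma rowingNormSq_insert {n k : ℕ} {g g' : ℕ → ℕ} (hk : k ≤ n)
    (h₁ : ∀ i < k, g' i = g i) (h₀ : g' k = 0) (h₂ : ∀ i, k ≤ i → g' (i + 1) = g i)
    (p : ℕ → ℝ) (c : ℝ) (s : ℕ → ℕ → ℝ) :
    rowingNormSq (n + 1) g' (fun t => if t ≤ k + 2 then p t else -p (t - 1)) c
      (fun i j => if i < k then s i j else -s (i - 1) j) =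
      rowingNormSq n g p c s + p (k + 2) ^ 2 := by
  unfold rowingNormSq
  rw [sum_range_succ_of_insert (n := n + 3) (k := k + 3) (f := fun t => p t ^ 2) (by omega)
      (fun i hi => by simp [show i ≤ k + 2 by omega])
      (fun i hi => by simp [show ¬ i + 1 ≤ k + 2 by omega]),
    sum_range_succ_of_insert (n := n) (k := k) (f := fun i => ∑ j ∈ range (g i), s i j ^ 2) hk
      (fun i hi => by simp [hi, h₁ i hi])
      (fun i hi => by simp [show ¬ i + 1 < k by omega, h₂ i hi])]
  simp [h₀]
  ring

lemma rowingQuad_insert {n k : ℕ} {g g' : ℕ → ℕ} (hk : k ≤ n)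
    (h₁ : ∀ i < k, g' i = g i) (h₀ : g' k = 0) (h₂ : ∀ i, k ≤ i → g' (i + 1) = g i)
    (p : ℕ → ℝ) (c : ℝ) (s : ℕ → ℕ → ℝ) :
    rowingQuad (n + 1) g' (fun t => if t ≤ k + 2 then p t else -p (t - 1)) c
      (fun i j => if i < k then s i j else -s (i - 1) j) =
      rowingQuad n g p c s - 2 * p (k + 2) ^ 2 := by
  unfold rowingQuad
  rw [sum_range_succ_of_insert (n := n + 2) (k := k + 2) (f := fun t => p t * p (t + 1)) (by omega)
      (fun i hi => by simp [show i ≤ k + 2 by omega, show i + 1 ≤ k + 2 by omega])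
      (fun i hi => by simp [show ¬ i + 1 ≤ k + 2 by omega, show ¬ i + 1 + 1 ≤ k + 2 by omega]),
    sum_range_succ_of_insert (n := n) (k := k)
      (f := fun i => 2 * (∑ j ∈ range (g i), s i j) * (p (i + 2) + p (i + 3)) +
        (∑ j ∈ range (g i), s i j) ^ 2 - ∑ j ∈ range (g i), s i j ^ 2) hk
      (fun i hi => by
        simp [hi, h₁ i hi, show i ≤ k by omega, show i + 3 ≤ k + 2 by omega])
      (fun i hi => by
        simp [show ¬ i + 1 < k by omega, h₂ i hi, show ¬ i + 1 + 2 ≤ k + 2 by omega,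
          show ¬ i + 1 + 3 ≤ k + 2 by omega]
        ring)]
  simp [h₀]
  ring

lemma getD_insert_zero (a : List ℕ) {k : ℕ} (hk : k ≤ a.length) :
    (a.take k ++ 0 :: a.drop k).length = a.length + 1 ∧
    (∀ i < k, (a.take k ++ 0 :: a.drop k).getD i 0 = a.getD i 0) ∧
    (a.take k ++ 0 :: a.drop k).getD k 0 = 0 ∧
    ∀ i, k ≤ i → (a.take k ++ 0 :: a.drop k).getD (i + 1) 0 = a.getD i 0 := by
  refine ⟨by simp; omega, fun i hi => ?_, ?_, fun i hi => ?_⟩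
  · simp [List.getElem?_append, hk, hi, show i < a.length by omega]
  · simp [hk]
  · simp [List.getElem?_append, hk, show ¬ i + 1 < k by omega,
      show i + 1 - k = (i - k) + 1 by omega, show k + (i - k) = i by omega]

lemma rowingMinEig_insert_zero_mul_le (a : List ℕ) {k : ℕ} (hk : k ≤ a.length)
    (p : ℕ → ℝ) (c : ℝ) (s : ℕ → ℕ → ℝ) :
    rowingMinEig (a.take k ++ 0 :: a.drop k) *
      (rowingNormSq a.length (fun i => a.getD i 0) p c s + p (k + 2) ^ 2) ≤
        rowingQuad a.length (fun i => a.getD i 0) p c s - 2 * p (k + 2) ^ 2 := by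
  obtain ⟨hl, h₁, h₀, h₂⟩ := getD_insert_zero a hk
  have := minEig_mul_dotProduct_le
    (isHermitian_adjMat (rowingGraph (a.take k ++ 0 :: a.drop k)))
    (rowingVec _ (fun t => if t ≤ k + 2 then p t else -p (t - 1)) c
      (fun i j => if i < k then s i j else -s (i - 1) j))
  change rowingMinEig (a.take k ++ 0 :: a.drop k) * _ ≤ _ at this
  rw [rowingVec_dotProduct_self, rowingVec_dotProduct_mulVec, hl,
    rowingNormSq_insert hk h₁ h₀ h₂, rowingQuad_insert hk h₁ h₀ h₂] at this
  exact this

/-- For every `ε > 0` there is `m ≥ 1` such that for every sequence of length at least `m`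
one can insert a `0` among the first `m` positions and decrease the smallest eigenvalue as
stated. Inserting a `0` before position `k` is `a.take (k-1) ++ 0 :: a.drop (k-1)`. -/
theorem rowing_insert_zero (ε : ℝ) (hε : 0 < ε) :
    ∃ m : ℕ, 0 < m ∧ ∀ a : List ℕ, m ≤ a.length →
      ∃ k : ℕ, 1 ≤ k ∧ k ≤ m ∧
        rowingMinEig (a.take (k - 1) ++ 0 :: a.drop (k - 1)) <
          (rowingMinEig a + ε) / (1 + ε / 2) := by
  obtain ⟨m, hm⟩ := exists_nat_gt (2 / ε)
  have hm0 : (0 : ℝ) < m := lt_trans (by positivity) hm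
  refine ⟨m, by exact_mod_cast hm0, fun a ha => ?_⟩
  obtain ⟨x, hx, hAx⟩ := isEigenvalue_minEig (isHermitian_adjMat (rowingGraph a))
  obtain ⟨p, c, s, rfl⟩ := exists_eq_rowingVec a x
  have hnonpos : rowingMinEig a ≤ 0 := minEig_adjMat_nonpos _
  set N := rowingNormSq a.length (fun i => a.getD i 0) p c s with hN
  have hNpos : 0 < N := by
    rw [hN, ← rowingVec_dotProduct_self]
    refine lt_of_le_of_ne (sum_nonneg fun i _ => mul_self_nonneg _) fun h => hx ?_
    exact dotProduct_self_eq_zero.1 h.symm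
  have hQ : rowingQuad a.length (fun i => a.getD i 0) p c s = rowingMinEig a * N := by
    rw [← rowingVec_dotProduct_mulVec, hAx, dotProduct_smul, rowingVec_dotProduct_self,
      smul_eq_mul, rowingMinEig]
  obtain ⟨k, hkm, hsmall⟩ : ∃ k < m, p (k + 2) ^ 2 ≤ N * (ε / 2) := by
    by_contra! hcon
    have hle : ∑ k ∈ range m, p (k + 2) ^ 2 ≤ N := by
      have hpath : ∑ k ∈ range m, p (k + 2) ^ 2 ≤ ∑ t ∈ range (a.length + 3), p t ^ 2 := by
        rw [show ∑ k ∈ range m, p (k + 2) ^ 2 = ∑ t ∈ (range m).map (addRightEmbedding 2), p t ^ 2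
          by simp]
        refine sum_le_sum_of_subset_of_nonneg (fun t ht => ?_) fun _ _ _ => sq_nonneg _
        simp only [mem_map, mem_range, addRightEmbedding_apply] at ht ⊢
        omega
      have hcliques : 0 ≤ ∑ i ∈ range a.length, ∑ j ∈ range (a.getD i 0), s i j ^ 2 :=
        sum_nonneg fun _ _ => sum_nonneg fun _ _ => sq_nonneg _
      rw [hN, rowingNormSq]
      linarith [sq_nonneg c]
    have hge : (m : ℝ) * (N * (ε / 2)) ≤ ∑ k ∈ range m, p (k + 2) ^ 2 := by
      have := card_nsmul_le_sum (range m) (fun k => p (k + 2) ^ 2) (N * (ε / 2))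
        fun k hk => (hcon k (by simpa using hk)).le
      simpa using this
    rw [div_lt_iff₀ hε] at hm
    nlinarith
  refine ⟨k + 1, by omega, hkm, ?_⟩
  rw [Nat.add_sub_cancel]
  have hkey := rowingMinEig_insert_zero_mul_le a (k := k) (by omega) p c s
  rw [hQ, ← hN] at hkey
  have hD : 0 < N + p (k + 2) ^ 2 := by positivity
  refine ((le_div_iff₀ hD).2 hkey).trans_lt ?_
  rw [div_lt_div_iff₀ hD (by positivity)]
  nlinarith [mul_nonneg (neg_nonneg.2 hnonpos) (sub_nonneg.2 hsmall), mul_pos hNpos hε,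
    mul_nonneg hε.le (sq_nonneg (p (k + 2))), sq_nonneg (p (k + 2))]
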